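/- arXiv:2302.14087 — 3 statements merged into one kernel-verified Lean document; each statement's English description precedes it below -/
import Mathlib

section
/- Let n ≥ 2 and let d be a real number with 0 < d < n−1. Every domain Ω ⊂ ℝⁿ whose boundary ∂Ω is d-Ahlfors regular with constant C_σ is a uniform domain: there exist ε ∈ (0,1) and N ∈ ℕ, depending only on n, d and C_σ, such that Ω satisfies the corkscrew condition with constant ε and the Harnack chain condition with constant N. -/
open MeasureTheory Metric Set

noncomputable section

/-- `ℝⁿ` as a Euclidean space. -/
abbrev Euc (n : ℕ) := EuclideanSpace ℝ (Fin n)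

/-- `σ` is a `d`-Ahlfors regular measure for the set `E`, with constant `Cσ`:
`σ` is supported on `E` and `Cσ⁻¹ r ^ d ≤ σ (B (x, r)) ≤ Cσ r ^ d` for `x ∈ E` and
`0 < r < diam E`. -/
def AhlforsRegular {n : ℕ} (E : Set (Euc n)) (σ : Measure (Euc n)) (d Cσ : ℝ) : Prop :=
  σ Eᶜ = 0 ∧
    ∀ x ∈ E, ∀ r : ℝ, 0 < r → ENNReal.ofReal r < EMetric.diam E →
      ENNReal.ofReal (Cσ⁻¹ * r ^ d) ≤ σ (ball x r) ∧
        σ (ball x r) ≤ ENNReal.ofReal (Cσ * r ^ d)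

/-- `E` (with measure `σ`) is uniformly `d`-rectifiable: big pieces of Lipschitz images. -/
def UniformlyRectifiable {n : ℕ} (E : Set (Euc n)) (σ : Measure (Euc n)) (d : ℕ) : Prop :=
  0 < d ∧ ∃ ε M : ℝ, 0 < ε ∧ 0 < M ∧
    ∀ x ∈ E, ∀ r : ℝ, 0 < r → ENNReal.ofReal r < EMetric.diam E →
      ∃ f : EuclideanSpace ℝ (Fin d) → Euc n, LipschitzWith M.toNNReal f ∧
        ENNReal.ofReal (ε * r ^ (d : ℝ)) ≤ σ (E ∩ ball x r ∩ f '' ball 0 r)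

/-- The corkscrew condition with constant `ε`. -/
def Corkscrew {n : ℕ} (Ω : Set (Euc n)) (ε : ℝ) : Prop :=
  ∀ x ∈ frontier Ω, ∀ r : ℝ, 0 < r → ENNReal.ofReal r < EMetric.diam Ω →
    ∃ X ∈ Ω ∩ ball x r, ball X (ε * r) ⊆ Ω

/-- The Harnack chain condition with constants `ε`, `N`. -/
def HarnackChains {n : ℕ} (Ω : Set (Euc n)) (ε : ℝ) (N : ℕ) : Prop :=
  ∀ X ∈ Ω, ∀ Y ∈ Ω,
    dist X Y ≤ 10 / ε * min (infDist X (frontier Ω)) (infDist Y (frontier Ω)) →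
      ∃ Z : Fin (N + 1) → Euc n, Z 0 = X ∧ Z (Fin.last N) = Y ∧
        ∀ i : Fin N, dist (Z i.castSucc) (Z i.succ) ≤ infDist (Z i.castSucc) (frontier Ω) / 2

/-- Uniform ellipticity and boundedness with constant `C₀` on `Ω`. -/
def UniformlyElliptic {n : ℕ} (Ω : Set (Euc n)) (A : Euc n → Fin n → Fin n → ℝ) (C₀ : ℝ) :
    Prop :=
  ∀ X ∈ Ω,
    (∀ ξ : Fin n → ℝ, C₀⁻¹ * ∑ i, ξ i ^ 2 ≤ ∑ i, ∑ j, A X i j * ξ j * ξ i) ∧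
      ∀ ξ ζ : Fin n → ℝ,
        |∑ i, ∑ j, A X i j * ξ j * ζ i| ≤
          C₀ * Real.sqrt (∑ i, ξ i ^ 2) * Real.sqrt (∑ i, ζ i ^ 2)

/-- The pointwise divergence `∑ i, ∂ᵢ Fᵢ` of a vector field `F`. -/
def pdiv {n : ℕ} (F : Euc n → Fin n → ℝ) (X : Euc n) : ℝ :=
  ∑ i, fderiv ℝ (fun Y => F Y i) X (EuclideanSpace.single i 1)

/-- The vector field `𝒜 ∇u`. -/
def matGrad {n : ℕ} (A : Euc n → Fin n → Fin n → ℝ) (u : Euc n → ℝ) (Y : Euc n) (i : Fin n) :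
    ℝ :=
  ∑ j, A Y i j * gradient u Y j

/-- The smooth distance `D_β` associated with the measure `σ`. -/
def Dbeta {n : ℕ} (σ : Measure (Euc n)) (d β : ℝ) (X : Euc n) : ℝ :=
  (∫ y, ‖X - y‖ ^ (-d - β) ∂σ) ^ (-β⁻¹)

/-- The Dahlberg–Kenig–Pipher condition with constant `M`, on a domain with
`(n-1)`-dimensional boundary. -/
def DKP {n : ℕ} (Ω : Set (Euc n)) (A : Euc n → Fin n → Fin n → ℝ) (M : ℝ) : Prop :=
  (∀ X ∈ Ω, infDist X (frontier Ω) * ‖fderiv ℝ A X‖ ≤ M) ∧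
    ∀ x ∈ frontier Ω, ∀ r : ℝ, 0 < r →
      ENNReal.ofReal r < 100 * EMetric.diam (frontier Ω) →
        ∫ X in ball x r ∩ Ω,
            (infDist X (frontier Ω) * ‖fderiv ℝ A X‖) ^ 2 * (infDist X (frontier Ω))⁻¹ ≤
          M ^ 2 * r ^ ((n : ℝ) - 1)

/-- The closed axis-parallel cube with center `x` and sidelength `ℓ`. -/
def cube {n : ℕ} (x : Euc n) (ℓ : ℝ) : Set (Euc n) := {Y | ∀ i, |Y i - x i| ≤ ℓ / 2}

/-- A ball of radius `R` centred on a `d`-Ahlfors regular set of positive diameter has measure at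
most `K * R ^ d`, also when `R` exceeds the diameter. -/
lemma AhlforsRegular.exists_measure_ball_le (n : ℕ) {d Cσ : ℝ} (hd : 0 < d) (hCσ : 1 ≤ Cσ) :
    ∃ K : ℝ, 0 < K ∧ ∀ (E : Set (Euc n)) (σ : Measure (Euc n)), AhlforsRegular E σ d Cσ →
      0 < ediam E → ∀ x ∈ E, ∀ R : ℝ, 0 < R → σ (ball x R) ≤ ENNReal.ofReal (K * R ^ d) := by
  obtain ⟨t, -, htf, ht⟩ := (isCompact_closedBall (0 : Euc n) 1).finite_cover_balls
    (e := 1 / 4) (by norm_num)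
  lift t to Finset (Euc n) using htf
  refine ⟨(t.card + 1) * Cσ, by positivity, fun E σ hσ hE x hx R hR => ?_⟩
  have hRd : 0 < R ^ d := Real.rpow_pos_of_pos hR d
  have htc : (0 : ℝ) ≤ t.card := Nat.cast_nonneg _
  rcases lt_or_ge (ENNReal.ofReal R) (ediam E) with h | h
  · refine (hσ.2 x hx R hR h).2.trans (ENNReal.ofReal_le_ofReal ?_)
    nlinarith [mul_nonneg htc (mul_nonneg (zero_le_one.trans hCσ) hRd.le)]
  have hfin : ediam E ≠ ⊤ := ne_top_of_le_ne_top ENNReal.ofReal_ne_top h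
  set D := (ediam E).toReal with hD
  have hDpos : 0 < D := ENNReal.toReal_pos hE.ne' hfin
  have hDE : ENNReal.ofReal D = ediam E := ENNReal.ofReal_toReal hfin
  have hDR : D ≤ R := by
    rw [← hDE] at h
    exact (ENNReal.ofReal_le_ofReal_iff hR.le).1 h
  have hball : ∀ c ∈ t, σ (E ∩ ball (x + D • c) (D / 4)) ≤ ENNReal.ofReal (Cσ * R ^ d) := by
    intro c _
    rcases (E ∩ ball (x + D • c) (D / 4)).eq_empty_or_nonempty with h0 | ⟨p, hp⟩
    · simp [h0]
    have hsub : E ∩ ball (x + D • c) (D / 4) ⊆ ball p (D / 2) := by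
      intro q hq
      have h1 := mem_ball.1 hq.2
      have h2 := mem_ball.1 hp.2
      have := dist_triangle_right q p (x + D • c)
      rw [mem_ball]
      linarith
    refine (measure_mono hsub).trans (((hσ.2 p hp.1 (D / 2) (by positivity) ?_).2).trans
      (ENNReal.ofReal_le_ofReal ?_))
    · refine lt_of_lt_of_eq ?_ hDE
      exact (ENNReal.ofReal_lt_ofReal_iff hDpos).2 (by linarith)
    · gcongr
      linarith
  have hcover : E ⊆ ⋃ c ∈ t, E ∩ ball (x + D • c) (D / 4) := by
    intro y hy
    have hyx : ‖y - x‖ ≤ D := by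
      rw [← dist_eq_norm, dist_edist]
      exact ENNReal.toReal_mono hfin (Metric.edist_le_ediam_of_mem hy hx)
    have hmem : D⁻¹ • (y - x) ∈ closedBall (0 : Euc n) 1 := by
      rw [mem_closedBall_zero_iff, norm_smul, norm_inv, Real.norm_of_nonneg hDpos.le]
      calc D⁻¹ * ‖y - x‖ ≤ D⁻¹ * D := by gcongr
        _ = 1 := inv_mul_cancel₀ hDpos.ne'
    obtain ⟨c, hc, hyc⟩ := mem_iUnion₂.1 (ht hmem)
    refine mem_iUnion₂.2 ⟨c, hc, hy, ?_⟩
    rw [mem_ball, dist_eq_norm] at hyc ⊢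
    have : y - (x + D • c) = D • (D⁻¹ • (y - x) - c) := by
      rw [smul_sub, smul_inv_smul₀ hDpos.ne']
      abel
    rw [this, norm_smul, Real.norm_of_nonneg hDpos.le]
    nlinarith
  calc σ (ball x R) ≤ σ (E ∪ Eᶜ) := measure_mono (by simp)
    _ ≤ σ E + σ Eᶜ := measure_union_le _ _
    _ = σ E := by rw [hσ.1, add_zero]
    _ ≤ σ (⋃ c ∈ t, E ∩ ball (x + D • c) (D / 4)) := measure_mono hcover
    _ ≤ ∑ c ∈ t, σ (E ∩ ball (x + D • c) (D / 4)) := measure_biUnion_finset_le _ _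
    _ ≤ ∑ _c ∈ t, ENNReal.ofReal (Cσ * R ^ d) := Finset.sum_le_sum hball
    _ = ENNReal.ofReal (t.card * (Cσ * R ^ d)) := by
      rw [Finset.sum_const, nsmul_eq_mul, ENNReal.ofReal_mul htc, ENNReal.ofReal_natCast]
    _ ≤ ENNReal.ofReal ((t.card + 1) * Cσ * R ^ d) := by
      apply ENNReal.ofReal_le_ofReal
      nlinarith [mul_pos (zero_lt_one.trans_le hCσ) hRd]

/-- A `2 * s`-separated family in an Ahlfors regular set contained in a ball of radius `R` has
at most a multiple of `((R + s) / s) ^ d` elements. -/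
lemma AhlforsRegular.card_mul_le {n : ℕ} {E : Set (Euc n)} {σ : Measure (Euc n)} {d Cσ K : ℝ}
    (hσ : AhlforsRegular E σ d Cσ) (hCσ : 1 ≤ Cσ) (hK : 0 < K)
    (hup : ∀ x ∈ E, ∀ R : ℝ, 0 < R → σ (ball x R) ≤ ENNReal.ofReal (K * R ^ d))
    {ι : Type*} [Fintype ι] {e : ι → Euc n} (he : ∀ i, e i ∈ E) {s R : ℝ} (hs : 0 < s)
    (hR : 0 ≤ R) (hsep : ∀ i j, i ≠ j → 2 * s ≤ dist (e i) (e j)) (i₀ : ι)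
    (hdist : ∀ i, dist (e i) (e i₀) ≤ R) (hsE : ENNReal.ofReal s < ediam E) :
    Fintype.card ι * (Cσ⁻¹ * s ^ d) ≤ K * (R + s) ^ d := by
  have hRs : 0 < R + s := by positivity
  have hCσ0 : 0 < Cσ := by positivity
  refine (ENNReal.ofReal_le_ofReal_iff (by positivity)).1 ?_
  calc ENNReal.ofReal (Fintype.card ι * (Cσ⁻¹ * s ^ d))
      = ∑ _i : ι, ENNReal.ofReal (Cσ⁻¹ * s ^ d) := by
        rw [Finset.sum_const, nsmul_eq_mul, ENNReal.ofReal_mul (Nat.cast_nonneg _),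
          ENNReal.ofReal_natCast, Finset.card_univ]
    _ ≤ ∑ i : ι, σ (ball (e i) s) :=
        Finset.sum_le_sum fun i _ => (hσ.2 (e i) (he i) s hs hsE).1
    _ = σ (⋃ i ∈ Finset.univ, ball (e i) s) := by
        refine (measure_biUnion_finset (fun i _ j _ hij => ball_disjoint_ball ?_)
          fun i _ => measurableSet_ball).symm
        linarith [hsep i j hij]
    _ ≤ σ (ball (e i₀) (R + s)) := by
        refine measure_mono (iUnion₂_subset fun i _ => ball_subset_ball' ?_)
        linarith [hdist i]
    _ ≤ ENNReal.ofReal (K * (R + s) ^ d) := hup _ (he i₀) _ hRs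

lemma exists_orthonormal_orthogonal (n : ℕ) (w : Euc n) :
    ∃ b : Fin (n - 1) → Euc n, Orthonormal ℝ b ∧ ∀ j, inner ℝ (b j) w = 0 := by
  have hle : n - 1 ≤ Module.finrank ℝ (Submodule.span ℝ {w})ᗮ := by
    have h1 := (Submodule.span ℝ {w}).finrank_add_finrank_orthogonal
    have h2 : Module.finrank ℝ (Submodule.span ℝ {w}) ≤ 1 := by
      simpa using finrank_span_le_card (R := ℝ) ({w} : Set (Euc n))
    rw [finrank_euclideanSpace_fin] at h1
    omega
  refine ⟨fun j => stdOrthonormalBasis ℝ (Submodule.span ℝ {w})ᗮ (Fin.castLE hle j), ?_, ?_⟩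
  · exact ((stdOrthonormalBasis ℝ (Submodule.span ℝ {w})ᗮ).orthonormal.comp_linearIsometry
      (Submodule.subtypeₗᵢ _)).comp _ (Fin.castLE_injective hle)
  · intro j
    exact Submodule.mem_orthogonal_singleton_iff_inner_left.1 (Subtype.prop _)

/-- A grid of `m ^ (n - 1)` translates of a segment, orthogonal to the segment, such that points
close to different translates are far apart. -/
lemma exists_separated_translates (n m : ℕ) (w : Euc n) {s : ℝ} (hs : 0 < s) :
    ∃ v : (Fin (n - 1) → Fin m) → Euc n, (∀ k, ‖v k‖ ≤ 4 * s * m * n) ∧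
      ∀ (a : Euc n) (k l : Fin (n - 1) → Fin m), k ≠ l → ∀ (t u : ℝ) (p q : Euc n),
        dist (a + v k + t • w) p < s → dist (a + v l + u • w) q < s → 2 * s ≤ dist p q := by
  obtain ⟨b, hb, hbw⟩ := exists_orthonormal_orthogonal n w
  have hinner : ∀ (k : Fin (n - 1) → Fin m) (j : Fin (n - 1)),
      inner ℝ (b j) (∑ i, (4 * s * (k i : ℝ)) • b i) = 4 * s * (k j : ℝ) :=
    fun k j => hb.inner_right_fintype (fun i => 4 * s * (k i : ℝ)) j
  refine ⟨fun k => ∑ i, (4 * s * (k i : ℝ)) • b i, fun k => ?_, ?_⟩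
  · calc ‖∑ i, (4 * s * (k i : ℝ)) • b i‖ ≤ ∑ i, ‖(4 * s * (k i : ℝ)) • b i‖ := norm_sum_le _ _
      _ ≤ ∑ _i : Fin (n - 1), 4 * s * m := by
        refine Finset.sum_le_sum fun i _ => ?_
        rw [norm_smul, hb.1 i, mul_one, Real.norm_of_nonneg (by positivity)]
        gcongr
        exact (k i).2.le
      _ = ((n - 1 : ℕ) : ℝ) * (4 * s * m) := by simp
      _ ≤ n * (4 * s * m) := by
        gcongr
        omega
      _ = 4 * s * m * n := by ring
  · intro a k l hkl t u p q hp hq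
    obtain ⟨j, hj⟩ := Function.ne_iff.1 hkl
    have hgap : 4 * s ≤ |4 * s * (k j : ℝ) - 4 * s * (l j : ℝ)| := by
      rw [← mul_sub, abs_mul, abs_of_pos (by positivity : (0 : ℝ) < 4 * s)]
      have hne : ((k j : ℕ) : ℤ) - ((l j : ℕ) : ℤ) ≠ 0 := by
        have : (k j : ℕ) ≠ (l j : ℕ) := fun h => hj (Fin.ext h)
        omega
      have h1 : (1 : ℝ) ≤ |(k j : ℝ) - (l j : ℝ)| := by
        exact_mod_cast Int.one_le_abs hne
      nlinarith
    have hproj : 4 * s * (k j : ℝ) - 4 * s * (l j : ℝ) =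
        inner ℝ (b j) ((a + ∑ i, (4 * s * (k i : ℝ)) • b i + t • w) -
          (a + ∑ i, (4 * s * (l i : ℝ)) • b i + u • w)) := by
      rw [inner_sub_right, inner_add_right, inner_add_right, inner_add_right, inner_add_right,
        hinner, hinner, inner_smul_right, inner_smul_right, hbw]
      ring
    have hle : |4 * s * (k j : ℝ) - 4 * s * (l j : ℝ)| ≤
        dist (a + ∑ i, (4 * s * (k i : ℝ)) • b i + t • w)
          (a + ∑ i, (4 * s * (l i : ℝ)) • b i + u • w) := by
      rw [hproj, dist_eq_norm]
      simpa [hb.1 j] using abs_real_inner_le_norm (b j)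
        ((a + ∑ i, (4 * s * (k i : ℝ)) • b i + t • w) -
          (a + ∑ i, (4 * s * (l i : ℝ)) • b i + u • w))
    have htri := dist_triangle4 (a + ∑ i, (4 * s * (k i : ℝ)) • b i + t • w) p q
      (a + ∑ i, (4 * s * (l i : ℝ)) • b i + u • w)
    rw [dist_comm q] at htri
    linarith

lemma exists_nat_mul_rpow_lt_pow {n : ℕ} (hn : 2 ≤ n) {d : ℝ} (hdn : d < (n : ℝ) - 1) (A : ℝ) :
    ∃ m : ℕ, 2 ≤ m ∧ A * (m : ℝ) ^ d < (m : ℝ) ^ (n - 1) := by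
  have h := ((tendsto_rpow_atTop (sub_pos.2 hdn)).comp
    tendsto_natCast_atTop_atTop).eventually_gt_atTop A
  obtain ⟨m, hm, hm2⟩ := (h.and (Filter.eventually_ge_atTop 2)).exists
  refine ⟨m, hm2, ?_⟩
  have hm0 : (0 : ℝ) < m := by positivity
  calc A * (m : ℝ) ^ d < (m : ℝ) ^ ((n : ℝ) - 1 - d) * (m : ℝ) ^ d :=
        mul_lt_mul_of_pos_right hm (Real.rpow_pos_of_pos hm0 d)
    _ = (m : ℝ) ^ (n - 1) := by
        rw [← Real.rpow_add hm0, sub_add_cancel, ← Real.rpow_natCast,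
          Nat.cast_sub (by omega), Nat.cast_one]

/-- Every segment has a small translate that stays quantitatively away from a given Ahlfors
regular set of dimension less than `n - 1`. -/
lemma AhlforsRegular.exists_translate_far {n : ℕ} (hn : 2 ≤ n) {d Cσ : ℝ} (hd : 0 < d)
    (hdn : d < (n : ℝ) - 1) (hCσ : 1 ≤ Cσ) {L : ℝ} (hL : 0 ≤ L) :
    ∃ η : ℝ, 0 < η ∧ η < 1 ∧ ∀ (E : Set (Euc n)) (σ : Measure (Euc n)), AhlforsRegular E σ d Cσ →
      E.Nonempty → ∀ (a w : Euc n) (r : ℝ), 0 < r → ‖w‖ ≤ L * r →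
        ∃ v : Euc n, ‖v‖ ≤ r / 4 ∧
          ∀ t ∈ Icc (0 : ℝ) 1, η * r ≤ infDist (a + v + t • w) E := by
  obtain ⟨K, hK, hup⟩ := AhlforsRegular.exists_measure_ball_le n hd hCσ
  obtain ⟨m, hm2, hm⟩ := exists_nat_mul_rpow_lt_pow hn hdn (Cσ * K * ((L + 4) * (16 * n)) ^ d)
  have hm2' : (2 : ℝ) ≤ m := by exact_mod_cast hm2
  have hn2' : (2 : ℝ) ≤ n := by exact_mod_cast hn
  have hη0 : 0 < ((16 : ℝ) * m * n)⁻¹ := by positivity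
  have hη1 : ((16 : ℝ) * m * n)⁻¹ < 1 := inv_lt_one_of_one_lt₀ (by nlinarith)
  refine ⟨(16 * m * n)⁻¹, hη0, hη1, fun E σ hσ hE a w r hr hw => ?_⟩
  set s := ((16 : ℝ) * m * n)⁻¹ * r with hs_def
  have hs : 0 < s := by positivity
  have hsr : s < r := by nlinarith
  obtain ⟨v, hv, hsep⟩ := exists_separated_translates n m w hs
  have hvr : ∀ k, ‖v k‖ ≤ r / 4 := fun k => (hv k).trans_eq (by rw [hs_def]; field_simp; norm_num)
  by_contra! hcon
  have hnear : ∀ k, ∃ t ∈ Icc (0 : ℝ) 1, ∃ e ∈ E, dist (a + v k + t • w) e < s := by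
    intro k
    obtain ⟨t, ht, hlt⟩ := hcon (v k) (hvr k)
    exact ⟨t, ht, (infDist_lt_iff hE).1 hlt⟩
  choose t ht e he hte using hnear
  have hesep : ∀ k l, k ≠ l → 2 * s ≤ dist (e k) (e l) := fun k l hkl =>
    hsep a k l hkl _ _ _ _ (hte k) (hte l)
  have hdist : ∀ k l, dist (e k) (e l) ≤ (L + 3) * r := by
    intro k l
    have h1 := dist_triangle4 (e k) (a + v k + t k • w) (a + v l + t l • w) (e l)
    have h2 : dist (a + v k + t k • w) (a + v l + t l • w) ≤ r / 4 + r / 4 + L * r := by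
      have h3 : a + v k + t k • w - (a + v l + t l • w) = v k - v l + (t k - t l) • w := by
        rw [sub_smul]
        abel
      rw [dist_eq_norm, h3]
      refine (norm_add_le _ _).trans (add_le_add ((norm_sub_le _ _).trans
        (add_le_add (hvr k) (hvr l))) ?_)
      rw [norm_smul]
      have h4 : ‖t k - t l‖ ≤ 1 := by
        rw [Real.norm_eq_abs, abs_le]
        constructor <;> linarith [(ht k).1, (ht k).2, (ht l).1, (ht l).2]
      calc ‖t k - t l‖ * ‖w‖ ≤ 1 * ‖w‖ := by gcongr
        _ ≤ L * r := by linarith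
    rw [dist_comm (e k) (a + v k + t k • w)] at h1
    linarith [hte k, hte l]
  have : NeZero m := ⟨by omega⟩
  have hsE : ENNReal.ofReal s < ediam E := by
    obtain ⟨k, l, hne⟩ : ∃ k l : Fin (n - 1) → Fin m, k ≠ l := by
      refine ⟨fun _ => ⟨0, by omega⟩, fun _ => ⟨1, by omega⟩, fun h => ?_⟩
      have := congrArg Fin.val (congrFun h ⟨0, by omega⟩)
      simp at this
    refine lt_of_lt_of_le ?_ (Metric.edist_le_ediam_of_mem (he k) (he l))
    rw [edist_dist]
    refine (ENNReal.ofReal_lt_ofReal_iff_of_nonneg hs.le).2 (lt_of_lt_of_le ?_ (hesep k l hne))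
    linarith
  have hcard := hσ.card_mul_le hCσ hK (hup E σ hσ (bot_le.trans_lt hsE)) he hs
    (by positivity) hesep 0 (fun k => hdist k 0) hsE
  have hcard' : ((m : ℝ) ^ (n - 1)) * (Cσ⁻¹ * s ^ d) ≤ K * ((L + 4) * r) ^ d := by
    refine le_trans (le_of_eq ?_) (hcard.trans ?_)
    · simp
    · gcongr
      linarith
  have hCσ0 : 0 < Cσ := by positivity
  have hsd : 0 < s ^ d := Real.rpow_pos_of_pos hs d
  have hsplit : ((L + 4) * r) ^ d = ((L + 4) * (16 * n)) ^ d * (m : ℝ) ^ d * s ^ d := by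
    rw [← Real.mul_rpow (by positivity) (by positivity),
      ← Real.mul_rpow (by positivity) (by positivity), hs_def]
    congr 1
    field_simp
  rw [hsplit] at hcard'
  have : (m : ℝ) ^ (n - 1) ≤ Cσ * K * ((L + 4) * (16 * n)) ^ d * (m : ℝ) ^ d := by
    refine le_of_mul_le_mul_right ?_ (mul_pos (inv_pos.2 hCσ0) hsd)
    refine hcard'.trans_eq ?_
    field_simp
  linarith

lemma mem_of_segment_disjoint_frontier {n : ℕ} {Ω : Set (Euc n)} {p q : Euc n} (hp : p ∈ Ω)
    (h : ∀ z ∈ segment ℝ p q, z ∉ frontier Ω) : q ∈ Ω := by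
  have hsub : segment ℝ p q ⊆ interior Ω := by
    refine (convex_segment p q).isPreconnected.subset_of_closure_inter_subset isOpen_interior
      ⟨p, left_mem_segment ℝ p q, ?_⟩ fun z hz => ?_
    · by_contra hpi
      exact h p (left_mem_segment ℝ p q) ⟨subset_closure hp, hpi⟩
    · by_contra hzi
      exact h z hz.2 ⟨closure_mono interior_subset hz.1, hzi⟩
  exact interior_subset (hsub (right_mem_segment ℝ p q))

lemma notMem_of_mem_segment_add_of_norm_lt {n : ℕ} {E : Set (Euc n)} {p v z : Euc n}
    (hv : ‖v‖ < infDist p E) (hz : z ∈ segment ℝ p (p + v)) : z ∉ E := by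
  intro hzE
  have h1 := infDist_le_dist_of_mem (x := p) hzE
  rw [segment_eq_image'] at hz
  obtain ⟨t, ht, rfl⟩ := hz
  rw [dist_self_add_right, add_sub_cancel_left, norm_smul, Real.norm_of_nonneg ht.1] at h1
  nlinarith [norm_nonneg v, ht.2]

/-- A domain whose frontier is Ahlfors regular of dimension less than `n - 1` contains the whole
complement of its frontier. -/
lemma AhlforsRegular.compl_frontier_subset {n : ℕ} (hn : 2 ≤ n) {d Cσ : ℝ} (hd : 0 < d)
    (hdn : d < (n : ℝ) - 1) (hCσ : 1 ≤ Cσ) {Ω : Set (Euc n)} {σ : Measure (Euc n)}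
    (hΩ : IsOpen Ω) (hne : Ω.Nonempty) (hσ : AhlforsRegular (frontier Ω) σ d Cσ)
    (hE : (frontier Ω).Nonempty) : (frontier Ω)ᶜ ⊆ Ω := by
  intro Y hY
  obtain ⟨X, hX⟩ := hne
  have hXf : X ∉ frontier Ω := fun h => disjoint_left.1 (disjoint_frontier_iff_isOpen.2 hΩ) h hX
  have hδX := (isClosed_frontier.notMem_iff_infDist_pos hE).1 hXf
  have hδY := (isClosed_frontier.notMem_iff_infDist_pos hE).1 hY
  set r := min (infDist X (frontier Ω)) (infDist Y (frontier Ω)) with hr_def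
  have hr : 0 < r := lt_min hδX hδY
  obtain ⟨η, hη, -, h⟩ := AhlforsRegular.exists_translate_far hn hd hdn hCσ
    (L := ‖Y - X‖ / r) (by positivity)
  obtain ⟨v, hv, hfar⟩ := h _ σ hσ hE X (Y - X) r hr (by field_simp; rfl)
  have hrX : r ≤ infDist X (frontier Ω) := min_le_left _ _
  have hrY : r ≤ infDist Y (frontier Ω) := min_le_right _ _
  have h1 : X + v ∈ Ω := mem_of_segment_disjoint_frontier hX fun z hz =>
    notMem_of_mem_segment_add_of_norm_lt (by linarith) hz
  have h2 : Y + v ∈ Ω := by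
    refine mem_of_segment_disjoint_frontier h1 fun z hz hzf => ?_
    rw [segment_eq_image'] at hz
    obtain ⟨t, ht, rfl⟩ := hz
    have h3 := hfar t ht
    rw [add_sub_add_right_eq_sub] at hzf
    rw [infDist_zero_of_mem hzf] at h3
    nlinarith
  refine mem_of_segment_disjoint_frontier h2 fun z hz => ?_
  rw [segment_symm] at hz
  exact notMem_of_mem_segment_add_of_norm_lt (by linarith) hz

/-- Harnack chains along a translate of a segment that stays away from `E`. -/
lemma exists_chain_of_translate_far {n m : ℕ} {E : Set (Euc n)} {X Y v : Euc n} {r η L : ℝ}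
    (hr : 0 < r) (hη : 0 < η) (hX : r ≤ infDist X E) (hY : r ≤ infDist Y E)
    (hXY : ‖Y - X‖ ≤ L * r) (hm : 2 * L / η < m) (hm0 : 0 < m) (hv : ‖v‖ ≤ r / 4)
    (hfar : ∀ t ∈ Icc (0 : ℝ) 1, η * r ≤ infDist (X + v + t • (Y - X)) E) :
    ∃ Z : Fin (m + 2 + 1) → Euc n, Z 0 = X ∧ Z (Fin.last (m + 2)) = Y ∧
      ∀ i : Fin (m + 2), dist (Z i.castSucc) (Z i.succ) ≤ infDist (Z i.castSucc) E / 2 := by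
  have hm0' : (0 : ℝ) < m := by exact_mod_cast hm0
  let z : ℕ → Euc n := fun i => if i = 0 then X else if i = m + 2 then Y else
    X + v + (((i - 1 : ℕ) : ℝ) / m) • (Y - X)
  refine ⟨fun i => z i, by simp [z], by simp [z], fun i => ?_⟩
  obtain ⟨i, hi⟩ := i
  simp only [Fin.val_castSucc, Fin.val_succ]
  rcases Nat.eq_zero_or_pos i with rfl | hi0
  · have h0 : z 0 = X := by simp [z]
    have h1 : z (0 + 1) = X + v := by simp [z]
    rw [h0, h1, dist_self_add_right]
    linarith
  have hzi : z i = X + v + (((i - 1 : ℕ) : ℝ) / m) • (Y - X) := by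
    simp only [z]
    rw [if_neg (by omega), if_neg (by omega)]
  rcases Nat.lt_or_ge i (m + 1) with him | him
  · have hzs : z (i + 1) = X + v + ((((i - 1 : ℕ) : ℝ) + 1) / m) • (Y - X) := by
      simp only [z]
      rw [if_neg (by omega), if_neg (by omega), ← Nat.cast_add_one,
        show i + 1 - 1 = i - 1 + 1 by omega]
    have hle : ((i - 1 : ℕ) : ℝ) ≤ m := by
      exact_mod_cast (by omega : i - 1 ≤ m)
    have h := hfar (((i - 1 : ℕ) : ℝ) / m) ⟨by positivity, (div_le_one hm0').2 hle⟩
    rw [← hzi] at h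
    have hd : dist (z i) (z (i + 1)) = ‖Y - X‖ / m := by
      rw [hzi, hzs, dist_add_left, dist_comm, dist_eq_norm, ← sub_smul, ← sub_div,
        add_sub_cancel_left, norm_smul, Real.norm_of_nonneg (by positivity)]
      ring
    rw [hd]
    have hL : 2 * L < m * η := (div_lt_iff₀ hη).1 hm
    have : ‖Y - X‖ / m ≤ η * r / 2 := by
      rw [div_le_iff₀ hm0']
      nlinarith
    linarith
  · obtain rfl : i = m + 1 := by omega
    have hz1 : z (m + 1) = Y + v := by
      rw [hzi, Nat.add_sub_cancel, div_self hm0'.ne', one_smul]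
      abel
    have hz2 : z (m + 1 + 1) = Y := by simp [z]
    rw [hz1, hz2, dist_self_add_left]
    have := infDist_le_infDist_add_dist (s := E) (x := Y) (y := Y + v)
    rw [dist_self_add_right] at this
    linarith

theorem low_dimensional_boundary_implies_uniform_domain
    (n : ℕ) (hn : 2 ≤ n) (d Cσ : ℝ) (hd : 0 < d) (hdn : d < (n : ℝ) - 1) (hCσ : 1 ≤ Cσ) :
    ∃ ε : ℝ, ∃ N : ℕ, 0 < ε ∧ ε < 1 ∧
      ∀ Ω : Set (Euc n), ∀ σ : Measure (Euc n),
        IsOpen Ω → IsConnected Ω → AhlforsRegular (frontier Ω) σ d Cσ →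
          Corkscrew Ω ε ∧ HarnackChains Ω ε N := by
  obtain ⟨ε, hε0, hε1, hcork⟩ :=
    AhlforsRegular.exists_translate_far hn hd hdn hCσ (L := 0) le_rfl
  have hL : 0 ≤ 10 / ε := by positivity
  obtain ⟨η, hη0, -, hchain⟩ := AhlforsRegular.exists_translate_far hn hd hdn hCσ hL
  obtain ⟨m, hm⟩ := exists_nat_gt (2 * (10 / ε) / η)
  have hm0 : 0 < m := by
    have : (0 : ℝ) < m := lt_of_le_of_lt (by positivity) hm
    exact_mod_cast this
  refine ⟨ε, m + 2, hε0, hε1, fun Ω σ hΩ hconn hσ => ⟨?_, ?_⟩⟩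
  · intro x hx r hr _
    have hE : (frontier Ω).Nonempty := ⟨x, hx⟩
    obtain ⟨v, hv, hfar⟩ := hcork _ σ hσ hE x 0 r hr (by simp)
    have hdist := hfar 0 ⟨le_rfl, zero_le_one⟩
    rw [smul_zero, add_zero] at hdist
    have hsub : ball (x + v) (ε * r) ⊆ Ω := by
      refine fun z hz =>
        hσ.compl_frontier_subset hn hd hdn hCσ hΩ hconn.nonempty hE fun hzf => ?_
      have h1 := infDist_le_dist_of_mem (x := x + v) hzf
      rw [mem_ball, dist_comm] at hz
      linarith
    refine ⟨x + v, ⟨hsub (mem_ball_self (by positivity)), ?_⟩, hsub⟩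
    rw [mem_ball, dist_self_add_left]
    linarith
  · intro X hX Y hY hXY
    rcases (frontier Ω).eq_empty_or_nonempty with hE | hE
    · obtain rfl : X = Y := by simpa [hE] using hXY
      exact ⟨fun _ => X, rfl, rfl, fun i => by simpa using div_nonneg infDist_nonneg zero_le_two⟩
    have hδ : ∀ Z ∈ Ω, 0 < infDist Z (frontier Ω) := fun Z hZ =>
      (isClosed_frontier.notMem_iff_infDist_pos hE).1
        (disjoint_right.1 (disjoint_frontier_iff_isOpen.2 hΩ) hZ)
    have hr := lt_min (hδ X hX) (hδ Y hY)
    rw [dist_comm, dist_eq_norm] at hXY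
    obtain ⟨v, hv, hfar⟩ := hchain _ σ hσ hE X (Y - X) _ hr hXY
    exact exists_chain_of_translate_far hr hη0 (min_le_left _ _) (min_le_right _ _) hXY hm hm0
      hv hfar
end
end

section
/- Let n ≥ 2 and let d be a real number with 0 ≤ d < n−1. Let Ω ⊂ ℝⁿ be a nonempty open connected set such that the d-dimensional Hausdorff measure ℋᵈ(∂Ω ∩ B) is finite for every ball B ⊂ ℝⁿ. Then Ω = ℝⁿ ∖ ∂Ω; equivalently, the complement of Ω has empty interior. -/
open MeasureTheory Metric Set

noncomputable section

/-- Every line meeting both `s` and its complement meets the frontier of `s`. -/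
theorem exists_lineMap_mem_frontier {E : Type*} [NormedAddCommGroup E] [NormedSpace ℝ E]
    {s : Set E} {a b : E} (ha : a ∈ s) (hb : b ∉ s) :
    ∃ t : ℝ, AffineMap.lineMap a b t ∈ frontier s := by
  have hcont : Continuous (AffineMap.lineMap a b : ℝ → E) := AffineMap.lineMap_continuous
  obtain ⟨t, ht⟩ : (frontier ((AffineMap.lineMap a b : ℝ → E) ⁻¹' s)).Nonempty := by
    refine nonempty_frontier_iff.2 ⟨⟨0, by simpa using ha⟩, fun h => hb ?_⟩
    simpa using (h ▸ mem_univ 1 : (1 : ℝ) ∈ (AffineMap.lineMap a b : ℝ → E) ⁻¹' s)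
  exact ⟨t, hcont.frontier_preimage_subset s ht⟩

/-- If a set and its complement both have nonempty interior, then the frontier has Hausdorff
dimension at least `dim E - 1`. -/
theorem finrank_le_dimH_frontier_add_one {E : Type*} [NormedAddCommGroup E]
    [InnerProductSpace ℝ E] [FiniteDimensional ℝ E] {s : Set E}
    (hs : (interior s).Nonempty) (hsc : (interior sᶜ).Nonempty) :
    (Module.finrank ℝ E : ENNReal) ≤ dimH (frontier s) + 1 := by
  obtain ⟨a, ha⟩ := hs
  obtain ⟨b, hb⟩ := hsc
  have hab : b - a ≠ 0 := fun h =>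
    interior_subset hb (sub_eq_zero.1 h ▸ interior_subset ha)
  set K : Submodule ℝ E := (ℝ ∙ (b - a))ᗮ
  have hrank : 1 + Module.finrank ℝ K = Module.finrank ℝ E := by
    rw [← finrank_span_singleton (K := ℝ) hab]
    exact Submodule.finrank_add_finrank_orthogonal _
  have hnhds : ∀ {c : E} {u : Set E}, c ∈ interior u → ∀ᶠ w : K in nhds 0, c + (w : E) ∈ u := by
    intro c u hc
    have hcont : Continuous fun w : K => c + (w : E) := by fun_prop
    exact hcont.continuousAt.eventually_mem (by simpa using mem_interior_iff_mem_nhds.1 hc)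
  let p : E → K := fun z => K.orthogonalProjectionOnto (z - a)
  have hp : LipschitzWith (1 * 1) p :=
    K.lipschitzWith_orthogonalProjectionOnto.comp (IsometryEquiv.subRight a).isometry.lipschitz
  have himage : p '' frontier s ∈ nhds (0 : K) := by
    filter_upwards [hnhds ha, hnhds hb] with w hwa hwb
    obtain ⟨t, ht⟩ := exists_lineMap_mem_frontier hwa hwb
    refine ⟨_, ht, ?_⟩
    have hz : AffineMap.lineMap (a + (w : E)) (b + (w : E)) t - a = t • (b - a) + (w : E) := by
      rw [AffineMap.lineMap_apply_module']
      module
    simp only [p, hz, map_add, map_smul, Submodule.orthogonalProjectionOnto_mem_subspace_eq_self]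
    rw [Submodule.orthogonalProjectionOnto_orthogonalComplement_singleton_eq_zero]
    simp
  calc (Module.finrank ℝ E : ENNReal) = dimH (p '' frontier s) + 1 := by
        rw [Real.dimH_of_mem_nhds himage, ← hrank]
        push_cast
        exact add_comm _ _
    _ ≤ dimH (frontier s) + 1 := by gcongr; exact hp.dimH_image_le _

/-- A set of locally finite `d`-dimensional Hausdorff measure has Hausdorff dimension at most
`d`. -/
theorem dimH_le_of_hausdorffMeasure_inter_ball_ne_top {X : Type*} [MetricSpace X]
    [MeasurableSpace X] [BorelSpace X] {s : Set X} {d : NNReal} (x : X)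
    (h : ∀ r : ℝ, μH[d] (s ∩ ball x r) ≠ ⊤) : dimH s ≤ d := by
  have hs : s = ⋃ k : ℕ, s ∩ ball x k := by rw [← inter_iUnion, iUnion_ball_nat, inter_univ]
  rw [hs, dimH_iUnion]
  exact iSup_le fun k => dimH_le_of_hausdorffMeasure_ne_top (h k)

theorem domain_with_thin_boundary_is_complement_of_boundary
    (n : ℕ) (hn : 2 ≤ n) (d : ℝ) (hd : 0 ≤ d) (hdn : d < (n : ℝ) - 1)
    (Ω : Set (Euc n)) (hΩopen : IsOpen Ω) (hΩconn : IsConnected Ω)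
    (hfin : ∀ x : Euc n, ∀ r : ℝ, μH[d] (frontier Ω ∩ ball x r) ≠ ⊤) :
    Ω = (frontier Ω)ᶜ := by
  lift d to NNReal using hd
  have hdim := dimH_le_of_hausdorffMeasure_inter_ball_ne_top 0 (hfin 0)
  have hempty : interior Ωᶜ = ∅ := by
    by_contra! hne
    have h := (finrank_le_dimH_frontier_add_one
      (hΩopen.interior_eq.symm ▸ hΩconn.nonempty) hne).trans (add_le_add_left hdim 1)
    rw [finrank_euclideanSpace_fin] at h
    have h' : (n : NNReal) ≤ d + 1 := by exact_mod_cast h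
    have h'' : (n : ℝ) ≤ d + 1 := by exact_mod_cast h'
    linarith
  have hclosure : closure Ω = univ := by
    rw [closure_eq_compl_interior_compl, hempty, compl_empty]
  rw [hΩopen.frontier_eq, hclosure, ← compl_eq_univ_sdiff, compl_compl]
end
end

section
/- Let Ω ⊂ ℝⁿ be open and let u, D be positive C² functions on Ω satisfying, for some constant C₀ > 0 and all points of Ω: D|∇u|/u ≤ C₀, |∇D| ≤ C₀, and |∇²D| ≤ C₀/D. Then there is a constant C₁ > 0, depending only on n and C₀, such that at every point of Ω: (1) D²|∇²u|/u ≤ C₁ ( D|∇ ln(u/D)| + D²|∇² ln(u/D)| + D|∇²D| ), and (2) D³|∇(|∇u|²)|/u² ≤ C₁ ( D²|∇² ln(u/D)| + D|∇ ln(u/D)| + D|∇(|∇D|²)| ). -/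
open MeasureTheory Metric Set

noncomputable section

section GradientCalculus

variable {E : Type*} [NormedAddCommGroup E] [InnerProductSpace ℝ E] [CompleteSpace E]

lemma norm_gradient_eq_norm_fderiv (f : E → ℝ) (x : E) : ‖gradient f x‖ = ‖fderiv ℝ f x‖ := by
  simp [gradient]

lemma ContDiffAt.differentiableAt_gradient {f : E → ℝ} {x : E} (hf : ContDiffAt ℝ 2 f x) :
    DifferentiableAt ℝ (gradient f) x := by
  have h : DifferentiableAt ℝ (fderiv ℝ f) x :=
    (hf.fderiv_right (m := 1) (by norm_num)).differentiableAt (by norm_num)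
  exact (InnerProductSpace.toDual ℝ E).symm.toContinuousLinearEquiv.differentiableAt.comp x h

lemma innerSL_gradient (f : E → ℝ) (x : E) : innerSL ℝ (gradient f x) = fderiv ℝ f x := by
  ext w
  simp [gradient]

lemma gradient_log {f : E → ℝ} {x : E} (hf : DifferentiableAt ℝ f x) (hx : f x ≠ 0) :
    gradient (fun y => Real.log (f y)) x = (f x)⁻¹ • gradient f x := by
  simp [gradient, fderiv.log hf hx]

lemma ContDiffAt.hasFDerivAt_inv_smul_gradient {f : E → ℝ} {x : E} (hf : ContDiffAt ℝ 2 f x)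
    (hx : f x ≠ 0) :
    HasFDerivAt (fun y => (f y)⁻¹ • gradient f y)
      ((f x)⁻¹ • fderiv ℝ (gradient f) x -
        (innerSL ℝ ((f x)⁻¹ • gradient f x)).smulRight ((f x)⁻¹ • gradient f x)) x := by
  have hd : HasFDerivAt f (fderiv ℝ f x) x := (hf.differentiableAt (by norm_num)).hasFDerivAt
  have hinv := (hasDerivAt_inv hx).comp_hasFDerivAt x hd
  refine (hinv.smul hf.differentiableAt_gradient.hasFDerivAt).congr_fderiv ?_
  ext w
  rw [← innerSL_gradient]
  simp only [sub_apply, add_apply, smul_apply, ContinuousLinearMap.smulRight_apply,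
    innerSL_apply_apply, real_inner_smul_left, smul_smul, smul_eq_mul, Function.comp_apply]
  rw [sub_eq_add_neg, ← neg_smul]
  congr 2
  field_simp

lemma fderiv_gradient_log_div {u D : E → ℝ} {x : E} (hu : ContDiffAt ℝ 2 u x)
    (hD : ContDiffAt ℝ 2 D x) (hux : u x ≠ 0) (hDx : D x ≠ 0) :
    gradient (fun y => Real.log (u y / D y)) x =
        (u x)⁻¹ • gradient u x - (D x)⁻¹ • gradient D x ∧
      fderiv ℝ (gradient (fun y => Real.log (u y / D y))) x =
        ((u x)⁻¹ • fderiv ℝ (gradient u) x -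
          (innerSL ℝ ((u x)⁻¹ • gradient u x)).smulRight ((u x)⁻¹ • gradient u x)) -
        ((D x)⁻¹ • fderiv ℝ (gradient D) x -
          (innerSL ℝ ((D x)⁻¹ • gradient D x)).smulRight ((D x)⁻¹ • gradient D x)) := by
  have hnear : ∀ᶠ y in nhds x, ContDiffAt ℝ 2 u y ∧ ContDiffAt ℝ 2 D y ∧ u y ≠ 0 ∧ D y ≠ 0 := by
    filter_upwards [hu.eventually (by simp), hD.eventually (by simp),
      hu.continuousAt.eventually_ne hux, hD.continuousAt.eventually_ne hDx] with y h₁ h₂ h₃ h₄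
    exact ⟨h₁, h₂, h₃, h₄⟩
  have hgrad : gradient (fun y => Real.log (u y / D y)) =ᶠ[nhds x]
      fun y => (u y)⁻¹ • gradient u y - (D y)⁻¹ • gradient D y := by
    filter_upwards [hnear.eventually_nhds] with y hy
    obtain ⟨hu', hD', hu0, hD0⟩ := hy.self_of_nhds
    have hdu : DifferentiableAt ℝ u y := hu'.differentiableAt (by norm_num)
    have hdD : DifferentiableAt ℝ D y := hD'.differentiableAt (by norm_num)
    have hlog : (fun z => Real.log (u z / D z)) =ᶠ[nhds y]
        fun z => Real.log (u z) - Real.log (D z) := by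
      filter_upwards [hy] with z hz
      exact Real.log_div hz.2.2.1 hz.2.2.2
    rw [← gradient_log hdu hu0, ← gradient_log hdD hD0]
    simp only [gradient]
    rw [hlog.fderiv_eq, fderiv_fun_sub (hdu.log hu0) (hdD.log hD0), map_sub]
  refine ⟨hgrad.self_of_nhds, ?_⟩
  rw [hgrad.fderiv_eq]
  exact ((hu.hasFDerivAt_inv_smul_gradient hux).sub
    (hD.hasFDerivAt_inv_smul_gradient hDx)).fderiv

lemma ContDiffAt.norm_gradient_norm_gradient_sq {f : E → ℝ} {x : E} (hf : ContDiffAt ℝ 2 f x) :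
    ‖gradient (fun y => ‖gradient f y‖ ^ 2) x‖ =
      2 * ‖(innerSL ℝ (gradient f x)).comp (fderiv ℝ (gradient f) x)‖ := by
  rw [norm_gradient_eq_norm_fderiv, hf.differentiableAt_gradient.hasFDerivAt.norm_sq.fderiv,
    two_smul, ← two_smul ℝ, norm_smul]
  norm_num

end GradientCalculus

section HessianAlgebra

variable {E : Type*} [NormedAddCommGroup E] [InnerProductSpace ℝ E]

lemma norm_smulRight_self_sub_le (g h : E) :
    ‖(innerSL ℝ g).smulRight g - (innerSL ℝ h).smulRight h‖ ≤ ‖g - h‖ * (‖g‖ + ‖h‖) := by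
  have hsplit : (innerSL ℝ g).smulRight g - (innerSL ℝ h).smulRight h =
      (innerSL ℝ (g - h)).smulRight g + (innerSL ℝ h).smulRight (g - h) := by
    ext w
    simp [sub_smul, smul_sub]
  rw [hsplit]
  refine (norm_add_le _ _).trans (le_of_eq ?_)
  simp only [ContinuousLinearMap.norm_smulRight_apply, innerSL_apply_norm]
  ring

lemma norm_hessian_le {g h : E} {A B H : E →L[ℝ] E}
    (hH : H = (A - (innerSL ℝ g).smulRight g) - (B - (innerSL ℝ h).smulRight h)) :
    ‖A‖ ≤ ‖H‖ + ‖g - h‖ * (‖g‖ + ‖h‖) + ‖B‖ := by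
  have hA : A = H + ((innerSL ℝ g).smulRight g - (innerSL ℝ h).smulRight h) + B := by
    rw [hH]; abel
  calc ‖A‖ ≤ ‖H‖ + ‖(innerSL ℝ g).smulRight g - (innerSL ℝ h).smulRight h‖ + ‖B‖ := by
        conv_lhs => rw [hA]
        exact norm_add₃_le
    _ ≤ _ := by gcongr; exact norm_smulRight_self_sub_le g h

lemma norm_innerSL_comp_hessian_le {g h : E} {A B H : E →L[ℝ] E}
    (hH : H = (A - (innerSL ℝ g).smulRight g) - (B - (innerSL ℝ h).smulRight h)) :
    ‖(innerSL ℝ g).comp A‖ ≤ ‖g‖ * (‖H‖ + ‖g - h‖ * (‖g‖ + ‖h‖)) + ‖g - h‖ * ‖B‖ +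
      ‖(innerSL ℝ h).comp B‖ := by
  have hA : (innerSL ℝ g).comp A =
      (innerSL ℝ g).comp (H + ((innerSL ℝ g).smulRight g - (innerSL ℝ h).smulRight h)) +
        (innerSL ℝ (g - h)).comp B + (innerSL ℝ h).comp B := by
    rw [hH]
    ext w
    simp only [ContinuousLinearMap.comp_apply, add_apply,
      sub_apply, innerSL_apply_apply, inner_sub_left, inner_sub_right,
      inner_add_right]
    ring
  rw [hA]
  refine norm_add₃_le.trans ?_
  gcongr
  · refine (ContinuousLinearMap.opNorm_comp_le _ _).trans ?_
    rw [innerSL_apply_norm]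
    gcongr
    exact (norm_add_le _ _).trans (by gcongr; exact norm_smulRight_self_sub_le g h)
  · refine (ContinuousLinearMap.opNorm_comp_le _ _).trans ?_
    rw [innerSL_apply_norm]

end HessianAlgebra

section Scaling

variable {C u d P H A B S T p q : ℝ}

lemma scaled_hessian_bound (hC : 0 ≤ C) (hu : 0 < u) (hd : 0 < d) (hP : 0 ≤ P) (hH : 0 ≤ H)
    (hB : 0 ≤ B) (hp : d * p / u ≤ C) (hq : q ≤ C)
    (h : u⁻¹ * A ≤ H + P * (u⁻¹ * p + d⁻¹ * q) + d⁻¹ * B) :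
    d ^ 2 * A / u ≤ (1 + 4 * C + 4 * C ^ 2) * (d * P + d ^ 2 * H + d * B) := by
  calc d ^ 2 * A / u = d ^ 2 * (u⁻¹ * A) := by ring
    _ ≤ d ^ 2 * (H + P * (u⁻¹ * p + d⁻¹ * q) + d⁻¹ * B) := by gcongr
    _ = d ^ 2 * H + d * P * (d * p / u + q) + d * B := by field_simp
    _ ≤ d ^ 2 * H + d * P * (C + C) + d * B := by gcongr
    _ ≤ (1 + 4 * C + 4 * C ^ 2) * (d * P + d ^ 2 * H + d * B) := by
      have h₁ : 0 ≤ (1 + 2 * C + 4 * C ^ 2) * (d * P) := by positivity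
      have h₂ : 0 ≤ (4 * C + 4 * C ^ 2) * (d ^ 2 * H + d * B) := by positivity
      linarith

lemma scaled_gradient_bound (hC : 0 ≤ C) (hu : 0 < u) (hd : 0 < d) (hP : 0 ≤ P) (hH : 0 ≤ H)
    (hT : 0 ≤ T) (hp₀ : 0 ≤ p) (hp : d * p / u ≤ C) (hq : q ≤ C) (hB : B * d ≤ C)
    (h : S / u ^ 2 ≤ u⁻¹ * p * (H + P * (u⁻¹ * p + d⁻¹ * q)) + P * (d⁻¹ * B) + T / d ^ 2) :
    d ^ 3 * (2 * S) / u ^ 2 ≤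
      (1 + 4 * C + 4 * C ^ 2) * (d ^ 2 * H + d * P + d * (2 * T)) := by
  calc d ^ 3 * (2 * S) / u ^ 2 = 2 * d ^ 3 * (S / u ^ 2) := by ring
    _ ≤ 2 * d ^ 3 *
        (u⁻¹ * p * (H + P * (u⁻¹ * p + d⁻¹ * q)) + P * (d⁻¹ * B) + T / d ^ 2) := by gcongr
    _ = 2 * (d * p / u * (d ^ 2 * H) + d * p / u * (d * P * (d * p / u + q)) +
        d * P * (B * d) + d * T) := by field_simp
    _ ≤ 2 * (C * (d ^ 2 * H) + C * (d * P * (C + C)) + d * P * C + d * T) := by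
      have h₁ : d * p / u * (d * P * (d * p / u + q)) ≤ C * (d * P * (C + C)) :=
        (mul_le_mul_of_nonneg_left (by gcongr) (by positivity)).trans
          (mul_le_mul_of_nonneg_right hp (by positivity))
      gcongr
    _ ≤ (1 + 4 * C + 4 * C ^ 2) * (d ^ 2 * H + d * P + d * (2 * T)) := by
      have h₁ : 0 ≤ (1 + 2 * C + 4 * C ^ 2) * (d ^ 2 * H) := by positivity
      have h₂ : 0 ≤ (1 + 2 * C) * (d * P) := by positivity
      have h₃ : 0 ≤ (4 * C + 4 * C ^ 2) * (d * (2 * T)) := by positivity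
      linarith

end Scaling

theorem pointwise_second_derivative_estimates (n : ℕ) (C₀ : ℝ) (hC₀ : 0 < C₀) :
    ∃ C₁ : ℝ, 0 < C₁ ∧
      ∀ Ω : Set (Euc n), IsOpen Ω →
        ∀ u D : Euc n → ℝ,
          ContDiffOn ℝ 2 u Ω → ContDiffOn ℝ 2 D Ω →
          (∀ X ∈ Ω, 0 < u X) → (∀ X ∈ Ω, 0 < D X) →
          (∀ X ∈ Ω, D X * ‖gradient u X‖ / u X ≤ C₀) →
          (∀ X ∈ Ω, ‖gradient D X‖ ≤ C₀) →
          (∀ X ∈ Ω, ‖fderiv ℝ (gradient D) X‖ ≤ C₀ / D X) →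
          ∀ X ∈ Ω,
            (D X ^ 2 * ‖fderiv ℝ (gradient u) X‖ / u X ≤
              C₁ * (D X * ‖gradient (fun Y => Real.log (u Y / D Y)) X‖ +
                D X ^ 2 * ‖fderiv ℝ (gradient (fun Y => Real.log (u Y / D Y))) X‖ +
                D X * ‖fderiv ℝ (gradient D) X‖)) ∧
            (D X ^ 3 * ‖gradient (fun Y => ‖gradient u Y‖ ^ 2) X‖ / u X ^ 2 ≤
              C₁ * (D X ^ 2 * ‖fderiv ℝ (gradient (fun Y => Real.log (u Y / D Y))) X‖ +
                D X * ‖gradient (fun Y => Real.log (u Y / D Y)) X‖ +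
                D X * ‖gradient (fun Y => ‖gradient D Y‖ ^ 2) X‖)) := by
  refine ⟨1 + 4 * C₀ + 4 * C₀ ^ 2, by positivity, ?_⟩
  intro Ω hΩ u D hu hD hu0 hD0 hgu hgD hHD X hX
  have huX := hu.contDiffAt (hΩ.mem_nhds hX)
  have hDX := hD.contDiffAt (hΩ.mem_nhds hX)
  have hup := hu0 X hX
  have hDp := hD0 X hX
  obtain ⟨hgrad, hhess⟩ := fderiv_gradient_log_div huX hDX hup.ne' hDp.ne'
  have hfst := norm_hessian_le hhess
  have hsnd := norm_innerSL_comp_hessian_le hhess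
  rw [← hgrad] at hfst hsnd
  rw [huX.norm_gradient_norm_gradient_sq, hDX.norm_gradient_norm_gradient_sq]
  have hcomp (c : ℝ) (hc : 0 < c) (g : Euc n) (A : Euc n →L[ℝ] Euc n) :
      ‖(innerSL ℝ (c⁻¹ • g)).comp (c⁻¹ • A)‖ = ‖(innerSL ℝ g).comp A‖ / c ^ 2 := by
    rw [map_smul, ContinuousLinearMap.smul_comp, ContinuousLinearMap.comp_smul, norm_smul,
      norm_smul, Real.norm_of_nonneg (inv_pos.2 hc).le]
    field_simp
  rw [hcomp _ hup, hcomp _ hDp] at hsnd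
  simp only [norm_smul, norm_inv, Real.norm_of_nonneg hup.le, Real.norm_of_nonneg hDp.le]
    at hfst hsnd
  have hg := hgu X hX
  have hh := hgD X hX
  have hB := hHD X hX
  rw [le_div_iff₀ hDp] at hB
  have hH := norm_nonneg (fderiv ℝ (gradient (fun Y => Real.log (u Y / D Y))) X)
  have hP := norm_nonneg (gradient (fun Y => Real.log (u Y / D Y)) X)
  have hB0 := norm_nonneg (fderiv ℝ (gradient D) X)
  have hT := norm_nonneg ((innerSL ℝ (gradient D X)).comp (fderiv ℝ (gradient D) X))
  exact ⟨scaled_hessian_bound hC₀.le hup hDp hP hH hB0 hg hh hfst,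
    scaled_gradient_bound hC₀.le hup hDp hP hH hT (by positivity) hg hh hB hsnd⟩
end
end
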